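/- Let (R₀, m₀) be a regular local ring. Then there exists a regular local ring (R₀', m₀') that is a flat extension of R₀ with m₀ R₀' = m₀' and such that the residue field R₀'/m₀' is algebraically closed. -/

import Mathlib

open IsLocalRing

/-- A Noetherian local ring is regular if its Krull dimension equals the minimal
number of generators of its maximal ideal, i.e. the dimension of the cotangent
space `m/m²` over the residue field. -/
def IsRegularLocal (A : Type) [CommRing A] [IsLocalRing A] : Prop :=
  IsNoetherianRing A ∧
    ringKrullDim A =
      (Module.finrank (ResidueField A) (CotangentSpace A) : WithBot (WithTop ℕ))



set_option maxHeartbeats 1000000 in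
/-- A ring with a f.g. maximal ideal such that all f.g. ideals are adically closed is Noetherian. -/
theorem noeth_of_closed (n : ℕ) : ∀ (A : Type) [CommRing A] (l : List A), l.length = n →
    (Ideal.ofList l).IsMaximal →
    (∀ I : Ideal A, I.FG → ∀ x, (∀ k : ℕ, x ∈ I ⊔ (Ideal.ofList l) ^ k) → x ∈ I) →
    IsNoetherianRing A := by
  classical
  induction n with
  | zero =>
    intro A _ l hs hm _
    rw [List.length_eq_zero_iff] at hs
    subst hs
    rw [Ideal.ofList_nil] at hm
    let := Ideal.Quotient.field (⊥ : Ideal A)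
    have : IsNoetherianRing (A ⧸ (⊥ : Ideal A)) := inferInstance
    exact isNoetherianRing_of_ringEquiv _ (RingEquiv.quotientBot A)
  | succ n ih =>
    intro A _ l hs hm hcl
    obtain ⟨x, t, rfl⟩ := List.exists_cons_of_length_eq_add_one hs
    set M := Ideal.ofList (x :: t) with hM
    have hxM : x ∈ M := Ideal.subset_span (by simp)
    let q := Ideal.Quotient.mk (Ideal.span {x})
    have hq : Function.Surjective q := Ideal.Quotient.mk_surjective
    have hker : RingHom.ker q = Ideal.span {x} := Ideal.mk_ker
    have h0 : q x = 0 := Ideal.Quotient.eq_zero_iff_mem.mpr (Ideal.mem_span_singleton_self x)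
    have hmap : Ideal.ofList (t.map q) = M.map q := by
      rw [hM, Ideal.map_ofList, List.map_cons, Ideal.ofList_cons, h0]
      simp
    have hle : Ideal.span {x} ≤ M := by rwa [Ideal.span_singleton_le_iff_mem]
    have hmm : (M.map q).IsMaximal := by
      refine (Ideal.map_eq_top_or_isMaximal_of_surjective q hq hm).resolve_left fun h => ?_
      have : (M.map q).comap q = ⊤ := by rw [h, Ideal.comap_top]
      rw [Ideal.comap_map_of_surjective' q hq, hker, sup_eq_left.mpr hle] at this
      exact hm.ne_top this
    have hsup : ∀ v : Finset A, (Ideal.span (v : Set A) ⊔ Ideal.span {x}).FG := by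
      intro v
      refine ⟨v ∪ {x}, ?_⟩
      rw [Finset.coe_union, Finset.coe_singleton]
      exact Submodule.span_union _ _
    have hN : IsNoetherianRing (A ⧸ Ideal.span {x}) := by
      refine ih _ (t.map q) (by simpa using hs) (hmap ▸ hmm) ?_
      rw [hmap]
      rintro I ⟨u, hu⟩ y hy
      obtain ⟨y, rfl⟩ := hq y
      let v : Finset A := u.image (Function.surjInv hq)
      have hv : (Ideal.span (v : Set A)).map q = I := by
        rw [← hu, Ideal.map_span]
        change Ideal.span _ = Ideal.span _
        congr 1
        simp only [v, Finset.coe_image, ← Set.image_comp]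
        rw [show q ∘ Function.surjInv hq = id from funext (Function.surjInv_eq hq)]
        simp
      have hmem : ∀ J : Ideal A, q y ∈ J.map q ↔ y ∈ J ⊔ Ideal.span {x} := by
        intro J
        have h := Ideal.comap_map_of_surjective' q hq J
        rw [hker] at h
        rw [← h, Ideal.mem_comap]
      rw [← hv, hmem]
      refine hcl _ ?_ y fun k => ?_
      · exact hsup v
      · have := hy k
        rw [← hv, ← Ideal.map_pow, ← Ideal.map_sup, hmem] at this
        rwa [sup_right_comm]
    refine IsNoetherianRing.of_prime fun P hP => ?_
    have hfg : (P.map q).FG := (isNoetherianRing_iff_ideal_fg _).mp hN _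
    obtain ⟨u, hu, hu'⟩ := Submodule.fg_span_iff_fg_span_finset_subset _ |>.mp hfg
    obtain ⟨v, hv, rfl⟩ := Finset.subset_set_image_iff.mp hu
    have hPv : P ≤ Ideal.span (v : Set A) ⊔ Ideal.span {x} := by
      have : P.map q = (Ideal.span (v : Set A)).map q := by
        rw [Ideal.map_span, ← Finset.coe_image]; exact hu'
      rw [← hker, ← Ideal.comap_map_of_surjective' q hq, ← this]
      exact Ideal.le_comap_map
    have hvP : Ideal.span (v : Set A) ≤ P := Ideal.span_le.mpr hv
    by_cases hx : x ∈ P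
    · have : P = Ideal.span (v : Set A) ⊔ Ideal.span {x} :=
        le_antisymm hPv (sup_le hvP (by rwa [Ideal.span_singleton_le_iff_mem]))
      rw [this]
      exact hsup v
    · refine ⟨v, le_antisymm hvP fun y hy => hcl _ ⟨v, rfl⟩ y fun k => ?_⟩
      suffices H : ∀ k : ℕ, ∀ y ∈ P, ∃ z ∈ P, y - x ^ k * z ∈ Ideal.span (v : Set A) by
        obtain ⟨z, -, hz⟩ := H k y hy
        have : y = (y - x ^ k * z) + x ^ k * z := by ring
        rw [this]
        exact Submodule.add_mem_sup hz (Ideal.mul_mem_right _ _ (Ideal.pow_mem_pow hxM k))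
      intro k
      induction k with
      | zero => intro y hy; exact ⟨y, hy, by simp⟩
      | succ k ihk =>
        intro y hy
        obtain ⟨z, hz, hyz⟩ := ihk y hy
        obtain ⟨a, ha, b, hb, hab⟩ := Submodule.mem_sup.mp (hPv hz)
        obtain ⟨c, rfl⟩ := Ideal.mem_span_singleton'.mp hb
        have hc : c ∈ P := by
          have : c * x ∈ P := by
            rw [show c * x = z - a by rw [← hab]; ring]
            exact P.sub_mem hz (hvP ha)
          exact (hP.mem_or_mem this).resolve_right hx
        refine ⟨c, hc, ?_⟩
        rw [show y - x ^ (k+1) * c = (y - x ^ k * z) + x ^ k * a by rw [← hab]; ring]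
        exact Ideal.add_mem _ hyz (Ideal.mul_mem_left _ _ ha)

/-- Noetherianity of a directed union of Noetherian local rings. -/
theorem noeth_union {B : Type} [CommRing B] {ι : Type} (A : ι → Type) [∀ i, CommRing (A i)]
    [∀ i, IsLocalRing (A i)] [∀ i, IsNoetherianRing (A i)] (φ : ∀ i, A i →+* B)
    (hdir : ∀ s : Finset B, ∃ i, ∀ x ∈ s, x ∈ (φ i).range)
    (hpure : ∀ i (I : Ideal (A i)), (I.map (φ i)).comap (φ i) ≤ I)
    (M : Ideal B) (hM : ∀ i, (maximalIdeal (A i)).map (φ i) = M) :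
    IsNoetherianRing B ∧ ∃ _ : IsLocalRing B, maximalIdeal B = M := by
  classical
  obtain ⟨i₀, -⟩ := hdir ∅
  have hnt : Nontrivial B := by
    by_contra h
    rw [not_nontrivial_iff_subsingleton] at h
    have := hpure i₀ ⊥ (x := 1) (by
      rw [Ideal.mem_comap]; rw [Subsingleton.elim (φ i₀ 1) 0]; exact zero_mem _)
    simp at this
  have hMtop : M ≠ ⊤ := by
    intro h
    have := hpure i₀ (maximalIdeal _) (x := 1) (by rw [hM, h]; trivial)
    exact (Ideal.ne_top_iff_one _).mp (maximalIdeal.isMaximal (A i₀)).ne_top this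
  have hunit : ∀ x, x ∉ M → IsUnit x := by
    intro x hx
    obtain ⟨i, hi⟩ := hdir {x}
    obtain ⟨y, rfl⟩ := hi x (by simp)
    refine RingHom.isUnit_map _ ?_
    by_contra hy
    exact hx (hM i ▸ Ideal.mem_map_of_mem _ ((mem_maximalIdeal _).mpr hy))
  have hunit' : ∀ x, x ∈ nonunits B ↔ x ∈ M :=
    fun x => ⟨fun h => by_contra fun h' => h (hunit x h'),
      fun h h' => hMtop (Ideal.eq_top_of_isUnit_mem _ h h')⟩
  have hloc : IsLocalRing B := .of_nonunits_add fun a b ha hb => by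
    rw [hunit'] at *; exact M.add_mem ha hb
  have hmax : maximalIdeal B = M := by
    ext x; rw [mem_maximalIdeal, hunit']
  refine ⟨?_, hloc, hmax⟩
  obtain ⟨s, hs⟩ : M.FG := by
    rw [← hM i₀]
    exact ((isNoetherianRing_iff_ideal_fg _).mp inferInstance _).map _
  have hs' : Ideal.ofList s.toList = M := by
    rw [← hs]; simp [Ideal.ofList]
  refine noeth_of_closed _ B s.toList rfl ?_ ?_
  · rw [hs', ← hmax]; exact maximalIdeal.isMaximal B
  · rw [hs']
    rintro I ⟨u, rfl⟩ x hx
    obtain ⟨i, hi⟩ := hdir (insert x u)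
    obtain ⟨y, rfl⟩ := hi x (by simp)
    have : (u : Set B) ⊆ φ i '' Set.univ := by
      intro b hb
      obtain ⟨c, hc⟩ := hi b (by simp at hb ⊢; tauto)
      exact ⟨c, trivial, hc⟩
    obtain ⟨v, -, rfl⟩ := Finset.subset_set_image_iff.mp this
    have e : Ideal.span ((v.image (φ i) : Finset B) : Set B) = (Ideal.span (v : Set (A i))).map (φ i) := by
      rw [Ideal.map_span, ← Finset.coe_image]
    change ∀ k, φ i y ∈ Ideal.span _ ⊔ _ at hx
    change φ i y ∈ Ideal.span _
    rw [e] at hx ⊢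
    apply Ideal.mem_map_of_mem
    set J := Ideal.span (v : Set (A i))
    have h1 : ∀ k, y ∈ J ⊔ maximalIdeal (A i) ^ k := by
      intro k
      apply hpure i
      rw [Ideal.mem_comap, Ideal.map_sup, Ideal.map_pow, hM]
      exact hx k
    have h2 := Ideal.iInf_pow_smul_eq_bot_of_isLocalRing (M := A i ⧸ J) (maximalIdeal (A i))
      (maximalIdeal.isMaximal (A i)).ne_top
    rw [← Ideal.Quotient.eq_zero_iff_mem, ← Submodule.mem_bot (A i), ← h2, Submodule.mem_iInf]
    intro k
    obtain ⟨a, ha, b, hb, hab⟩ := Submodule.mem_sup.mp (h1 k)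
    have : Ideal.Quotient.mk J y = b • (1 : A i ⧸ J) := by
      rw [← hab, map_add, Ideal.Quotient.eq_zero_iff_mem.mpr ha, zero_add, Algebra.smul_def, mul_one]
      rfl
    rw [this]
    exact Submodule.smul_mem_smul hb trivial

theorem isDomain_of_regular (n : ℕ) : ∀ (A : Type) [CommRing A] [IsRegularLocalRing A],
    (maximalIdeal A).spanFinrank = n → IsDomain A := by
  classical
  induction n with
  | zero =>
    intro A _ _ h
    rw [Submodule.spanFinrank_eq_zero_iff_eq_bot ((maximalIdeal A).fg_of_isNoetherianRing)] at h
    exact (isField_iff_maximalIdeal_eq.mpr h).isDomain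
  | succ n ih =>
    intro A _ _ h
    have hdim := IsRegularLocalRing.spanFinrank_maximalIdeal (R := A)
    rw [h] at hdim
    have hmfg := (maximalIdeal A).fg_of_isNoetherianRing
    have hfin : (minimalPrimes A).Finite := minimalPrimes.finite_of_isNoetherianRing A
    -- find x
    obtain ⟨x, hxm, hx2, hxp⟩ : ∃ x ∈ maximalIdeal A, x ∉ maximalIdeal A ^ 2 ∧
        ∀ p ∈ minimalPrimes A, x ∉ p := by
      by_contra! hcon
      have hsub : ((maximalIdeal A : Ideal A) : Set A) ⊆
          ⋃ i ∈ ((insert (maximalIdeal A ^ 2) hfin.toFinset : Finset (Ideal A)) : Set (Ideal A)),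
            ((id i : Ideal A) : Set A) := by
        intro x hx
        simp only [Set.mem_iUnion]
        by_cases hx2 : x ∈ maximalIdeal A ^ 2
        · exact ⟨_, by simp, hx2⟩
        · obtain ⟨p, hp, hxp⟩ := hcon x hx hx2
          exact ⟨p, by simp [hp], hxp⟩
      rw [Ideal.subset_union_prime (maximalIdeal A ^ 2) (maximalIdeal A ^ 2)] at hsub
      · obtain ⟨p, hp, hle⟩ := hsub
        rw [Finset.mem_insert] at hp
        rcases hp with rfl | hp
        · have hid : IsIdempotentElem (maximalIdeal A) := by
            apply le_antisymm Ideal.mul_le_left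
            rw [← pow_two]; exact hle
          rw [Ideal.isIdempotentElem_iff_eq_bot_or_top_of_isLocalRing] at hid
          rcases hid with hid | hid
          · rw [hid] at h; simp at h
          · exact (maximalIdeal.isMaximal A).ne_top hid
        · rw [Set.Finite.mem_toFinset] at hp
          have hpp : p.IsPrime := hp.1.1
          have : p = maximalIdeal A := le_antisymm (le_maximalIdeal hpp.ne_top) hle
          have h0 : (maximalIdeal A).height = 0 := by
            rw [← this, Ideal.height_eq_zero_iff]
            exact hp
          rw [← maximalIdeal_height_eq_ringKrullDim, h0] at hdim
          exact absurd hdim (by norm_cast)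
      · intro i hi hi1 _
        rw [Finset.mem_insert] at hi
        have := hi.resolve_left hi1
        rw [Set.Finite.mem_toFinset] at this
        exact this.1.1
    let q := Ideal.Quotient.mk (Ideal.span {x})
    have hq : Function.Surjective q := Ideal.Quotient.mk_surjective
    have hle : Ideal.span {x} ≤ maximalIdeal A := by rwa [Ideal.span_singleton_le_iff_mem]
    have : Nontrivial (A ⧸ Ideal.span {x}) := Ideal.Quotient.nontrivial_iff.mpr
      fun h => (maximalIdeal.isMaximal A).ne_top (top_le_iff.mp (h ▸ hle))
    have hloc : IsLocalRing (A ⧸ Ideal.span {x}) := IsLocalRing.of_surjective' q hq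
    have hmm : maximalIdeal (A ⧸ Ideal.span {x}) = (maximalIdeal A).map q := by
      symm
      apply eq_maximalIdeal
      refine (Ideal.map_eq_top_or_isMaximal_of_surjective q hq
        (maximalIdeal.isMaximal A)).resolve_left fun h => ?_
      have h2 : ((maximalIdeal A).map q).comap q = ⊤ := by rw [h, Ideal.comap_top]
      have hker : RingHom.ker q = Ideal.span {x} := Ideal.mk_ker
      rw [Ideal.comap_map_of_surjective' q hq, hker, sup_eq_left.mpr hle] at h2
      exact (maximalIdeal.isMaximal A).ne_top h2
    -- generators
    have hrk : (maximalIdeal (A ⧸ Ideal.span {x})).spanFinrank ≤ n := by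
      obtain ⟨s, hs, hspan⟩ := Submodule.FG.exists_span_finset_card_eq_spanFinrank hmfg
      rw [h] at hs
      have hxs : x ∈ Submodule.span A (s : Set A) := by rw [hspan]; exact hxm
      obtain ⟨f, -, hf⟩ := Submodule.mem_span_finset.mp hxs
      obtain ⟨y, hys, hy⟩ : ∃ y ∈ s, IsUnit (f y) := by
        by_contra! hcon
        apply hx2
        rw [← hf, pow_two]
        refine Ideal.sum_mem _ fun y hy => ?_
        refine Ideal.mul_mem_mul ((mem_maximalIdeal _).mpr (hcon y hy)) ?_
        rw [← hspan]; exact Submodule.subset_span hy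
      have hspan' : maximalIdeal (A ⧸ Ideal.span {x}) =
          Submodule.span _ ((s.erase y).image q : Set (A ⧸ Ideal.span {x})) := by
        rw [hmm, ← hspan]
        change Ideal.map q (Ideal.span _) = Ideal.span _
        rw [Ideal.map_span]
        apply le_antisymm
        · rw [Ideal.span_le]
          have hother : ∀ z ∈ s, z ≠ y → q z ∈ Ideal.span ((s.erase y).image q : Set (A ⧸ Ideal.span {x})) := by
            intro z hz hzy
            exact Ideal.subset_span (by
              rw [Finset.coe_image]
              exact ⟨z, by simpa using ⟨hz, hzy⟩, rfl⟩)
          rintro _ ⟨z, hz, rfl⟩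
          by_cases hzy : z = y
          · subst hzy
            have h0 : q (∑ a ∈ s, f a • a) = 0 := by
              rw [hf]; exact Ideal.Quotient.eq_zero_iff_mem.mpr (Ideal.mem_span_singleton_self x)
            rw [← Finset.add_sum_erase _ _ hz, map_add, smul_eq_mul, map_mul] at h0
            have h1 : q (f z) * q z ∈ Ideal.span ((s.erase z).image q : Set (A ⧸ Ideal.span {x})) := by
              rw [eq_neg_of_add_eq_zero_left h0, map_sum]
              refine neg_mem (Ideal.sum_mem _ fun w hw => ?_)
              rw [smul_eq_mul, map_mul]
              exact Ideal.mul_mem_left _ _ (hother w (Finset.mem_of_mem_erase hw) (Finset.ne_of_mem_erase hw))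
            exact (Ideal.unit_mul_mem_iff_mem _ (hy.map q)).mp h1
          · exact hother z hz hzy
        · apply Ideal.span_mono
          rw [Finset.coe_image]
          exact Set.image_mono (by simp)
      rw [hspan']
      refine (Submodule.spanFinrank_span_le_ncard_of_finite (Finset.finite_toSet _)).trans ?_
      rw [Set.ncard_coe_finset]
      refine Finset.card_image_le.trans ?_
      rw [Finset.card_erase_of_mem hys, hs]; rfl
    have hd1 : ringKrullDim A ≤ ringKrullDim (A ⧸ Ideal.span {x}) + 1 := by
      rw [← maximalIdeal_height_eq_ringKrullDim]
      exact Ideal.height_le_ringKrullDim_quotient_add_one hxm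
    have hdq := ringKrullDim_le_spanFinrank_maximalIdeal (A ⧸ Ideal.span {x})
    rw [← hdim] at hd1
    have hge : (n : WithBot ℕ∞) ≤ ringKrullDim (A ⧸ Ideal.span {x}) := by
      push_cast at hd1
      generalize ringKrullDim (A ⧸ Ideal.span {x}) = d at hd1
      induction d with
      | bot => simp at hd1
      | coe d =>
        induction d with
        | top => exact le_top
        | coe d => norm_cast at hd1 ⊢; omega
    have hreg : IsRegularLocalRing (A ⧸ Ideal.span {x}) :=
      .of_spanFinrank_maximalIdeal_le _ (le_trans (by exact_mod_cast hrk) hge)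
    have hrk' : (maximalIdeal (A ⧸ Ideal.span {x})).spanFinrank = n :=
      le_antisymm hrk (by exact_mod_cast hge.trans hdq)
    have hdom := ih _ hrk'
    have hprime : (Ideal.span {x}).IsPrime := (Ideal.Quotient.isDomain_iff_prime _).mp hdom
    obtain ⟨p, hp, hpx⟩ := Ideal.exists_minimalPrimes_le (I := ⊥) (J := Ideal.span {x}) bot_le
    have hpp : p.IsPrime := hp.1.1
    have hpbot : p = ⊥ := by
      refine Submodule.eq_bot_of_le_smul_of_le_jacobson_bot (maximalIdeal A) p
        p.fg_of_isNoetherianRing ?_ (maximalIdeal_le_jacobson _)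
      intro y hy
      obtain ⟨z, rfl⟩ := Ideal.mem_span_singleton'.mp (hpx hy)
      have hz : z ∈ p := (hpp.mem_or_mem hy).resolve_right (hxp p hp)
      rw [mul_comm]
      exact Submodule.smul_mem_smul hxm hz
    rw [hpbot] at hpp
    have : IsDomain (A ⧸ (⊥ : Ideal A)) := (Ideal.Quotient.isDomain_iff_prime _).mpr hpp
    exact (RingEquiv.quotientBot A).symm.isDomain

theorem regular_of_flat {R B : Type} [CommRing R] [CommRing B] [Algebra R B] [IsRegularLocalRing R]
    [IsLocalRing B] [IsNoetherianRing B] [Module.Flat R B]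
    (hm : (maximalIdeal R).map (algebraMap R B) = maximalIdeal B) : IsRegularLocalRing B := by
  apply IsRegularLocalRing.of_spanFinrank_maximalIdeal_le
  have h1 : (maximalIdeal B).spanFinrank ≤ (maximalIdeal R).spanFinrank := by
    rw [← hm]
    exact Ideal.spanFinrank_map_le_of_fg _ (maximalIdeal R).fg_of_isNoetherianRing
  refine le_trans (b := ringKrullDim R) ?_ ?_
  · rw [← IsRegularLocalRing.spanFinrank_maximalIdeal (R := R)]; exact_mod_cast h1
  · rw [← maximalIdeal_height_eq_ringKrullDim, ← maximalIdeal_height_eq_ringKrullDim]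
    have e1 := PrimeSpectrum.height_eq_orderHeight (⟨maximalIdeal R, inferInstance⟩ : PrimeSpectrum R)
    have e2 := PrimeSpectrum.height_eq_orderHeight (⟨maximalIdeal B, inferInstance⟩ : PrimeSpectrum B)
    dsimp only at e1 e2
    rw [e1, e2]
    norm_cast
    refine Order.height_le fun l hl => ?_
    have : (maximalIdeal B).LiesOver l.last.asIdeal := by
      rw [hl]
      refine ⟨?_⟩
      change maximalIdeal R = _
      refine (maximalIdeal.isMaximal R).eq_of_le ?_ ?_
      · exact Ideal.IsPrime.ne_top inferInstance
      · rw [← hm]; exact Ideal.le_comap_map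
    obtain ⟨L, hL, hlast, -⟩ := Ideal.exists_ltSeries_of_hasGoingDown l (maximalIdeal B)
    rw [← hL]
    exact Order.length_le_height (by rw [hlast])

section FlatExt
open Polynomial

theorem adjoinRoot_local {A : Type} [CommRing A] [IsLocalRing A] (f : A[X]) (hf : f.Monic)
    (hirr : Irreducible (f.map (residue A))) :
    ∃ _ : IsLocalRing (AdjoinRoot f),
      (maximalIdeal A).map (algebraMap A (AdjoinRoot f)) = maximalIdeal (AdjoinRoot f) := by
  have hmax : ((maximalIdeal A).map (AdjoinRoot.of f)).IsMaximal := by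
    have h1 : (Ideal.span {f.map (Ideal.Quotient.mk (maximalIdeal A))}).IsMaximal := by
      let : Field (A ⧸ maximalIdeal A) := Ideal.Quotient.field _
      have : Irreducible (f.map (Ideal.Quotient.mk (maximalIdeal A))) := hirr
      exact PrincipalIdealRing.isMaximal_of_irreducible this
    rw [Ideal.Quotient.maximal_ideal_iff_isField_quotient] at h1 ⊢
    exact (AdjoinRoot.quotAdjoinRootEquivQuotPolynomialQuot (maximalIdeal A) f).toMulEquiv.isField h1
  have hfin : Module.Finite A (AdjoinRoot f) := hf.finite_adjoinRoot
  have huniq : ∀ N : Ideal (AdjoinRoot f), N.IsMaximal → N = (maximalIdeal A).map (AdjoinRoot.of f) := by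
    intro N hN
    symm
    refine hmax.eq_of_le hN.ne_top ?_
    have : (N.comap (algebraMap A (AdjoinRoot f))).IsMaximal := 
      Ideal.isMaximal_comap_of_isIntegral_of_isMaximal N
    rw [Ideal.map_le_iff_le_comap]
    exact (eq_maximalIdeal this).ge
  have hloc : IsLocalRing (AdjoinRoot f) := .of_unique_max_ideal ⟨_, hmax, huniq⟩
  exact ⟨hloc, (huniq _ (maximalIdeal.isMaximal _)).symm⟩

/-- good subalgebras -/
def GoodSub (R K : Type) [CommRing R] [IsLocalRing R] [Field K] [Algebra R K]
    (A : Subalgebra R K) : Prop :=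
  IsNoetherianRing A ∧ ∃ _ : IsLocalRing A,
    (maximalIdeal R).map (algebraMap R A) = maximalIdeal A ∧ Module.Flat R A

/-- pure inclusions -/
def PureSub {R K : Type} [CommRing R] [Field K] [Algebra R K]
    (A B : Subalgebra R K) : Prop :=
  ∃ h : A ≤ B, ∀ I : Ideal A, (I.map (Subalgebra.inclusion h).toRingHom).comap
    (Subalgebra.inclusion h).toRingHom ≤ I

theorem PureSub.refl {R K : Type} [CommRing R] [Field K] [Algebra R K]
    (A : Subalgebra R K) : PureSub A A := by
  refine ⟨le_rfl, fun I => ?_⟩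
  have : (Subalgebra.inclusion (le_refl A)).toRingHom = RingHom.id A := by ext; rfl
  rw [this]; simp

theorem PureSub.trans {R K : Type} [CommRing R] [Field K] [Algebra R K]
    {A B C : Subalgebra R K} (h1 : PureSub A B) (h2 : PureSub B C) : PureSub A C := by
  obtain ⟨h1, H1⟩ := h1
  obtain ⟨h2, H2⟩ := h2
  refine ⟨h1.trans h2, fun I => ?_⟩
  have : (Subalgebra.inclusion (h1.trans h2)).toRingHom =
    (Subalgebra.inclusion h2).toRingHom.comp (Subalgebra.inclusion h1).toRingHom := by ext; rfl
  rw [this, ← Ideal.map_map, ← Ideal.comap_comap]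
  exact (Ideal.comap_mono (H2 _)).trans (H1 _)

theorem goodSub_of_equiv {R K : Type} [CommRing R] [IsLocalRing R] [Field K] [Algebra R K]
    (A : Subalgebra R K) (B : Type) [CommRing B] [Algebra R B] [IsNoetherianRing B] [IsLocalRing B]
    (hm : (maximalIdeal R).map (algebraMap R B) = maximalIdeal B) [Module.Flat R B]
    (e : B ≃ₐ[R] A) : GoodSub R K A := by
  have h1 : IsLocalRing A := e.toRingEquiv.isLocalRing
  refine ⟨isNoetherianRing_of_ringEquiv B e.toRingEquiv, h1, ?_, ?_⟩
  · have : algebraMap R A = (e.toRingEquiv : B →+* A).comp (algebraMap R B) := by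
      ext r
      simp
    rw [this, ← Ideal.map_map, hm]
    exact map_ringEquiv_maximalIdeal e.toRingEquiv
  · exact Module.Flat.of_linearEquiv e.symm.toLinearEquiv

theorem chain_bound {R K : Type} [CommRing R] [IsLocalRing R] [Field K] [Algebra R K]
    (c : Set {A : Subalgebra R K // GoodSub R K A})
    (hc : IsChain (fun A B => PureSub A.1 B.1) c) (hne : c.Nonempty) :
    ∃ U : {A : Subalgebra R K // GoodSub R K A}, ∀ A ∈ c, PureSub A.1 U.1 := by
  classical
  have : Nonempty c := hne.to_subtype
  let F : c → Subalgebra R K := fun A => A.1.1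
  have htot : ∀ i j : c, ∃ k : c, PureSub (F i) (F k) ∧ PureSub (F j) (F k) := by
    intro i j
    rcases eq_or_ne i.1 j.1 with h | h
    · exact ⟨i, PureSub.refl _, by rw [Subtype.ext h]; exact PureSub.refl _⟩
    · rcases hc i.2 j.2 h with h | h
      · exact ⟨j, h, PureSub.refl _⟩
      · exact ⟨i, PureSub.refl _, h⟩
  have hdirF : Directed (· ≤ ·) F := fun i j => by
    obtain ⟨k, ⟨h1, -⟩, ⟨h2, -⟩⟩ := htot i j
    exact ⟨k, h1, h2⟩
  let U : Subalgebra R K := ⨆ i, F i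
  have hU : ∀ x : K, x ∈ U ↔ ∃ i, x ∈ F i := by
    intro x
    have := Subalgebra.coe_iSup_of_directed hdirF
    rw [← SetLike.mem_coe, this]; simp
  have hFU : ∀ i, F i ≤ U := fun i => le_iSup F i
  have hdir : ∀ s : Finset U, ∃ i, ∀ x ∈ s, x ∈ (Subalgebra.inclusion (hFU i)).toRingHom.range := by
    intro s
    have hmem : ∀ i (x : U), x ∈ (Subalgebra.inclusion (hFU i)).toRingHom.range ↔ (x : K) ∈ F i := by
      intro i x
      constructor
      · rintro ⟨y, rfl⟩; exact y.2
      · intro h; exact ⟨⟨x, h⟩, rfl⟩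
    simp only [hmem]
    induction s using Finset.induction_on with
    | empty => exact ⟨Classical.arbitrary _, by simp⟩
    | insert a s _ ih =>
      obtain ⟨i, hi⟩ := ih
      obtain ⟨j, hj⟩ := (hU a).mp a.2
      obtain ⟨k, h1, h2⟩ := hdirF i j
      refine ⟨k, fun x hx => ?_⟩
      rcases Finset.mem_insert.mp hx with rfl | hx
      · exact h2 hj
      · exact h1 (hi x hx)
  have hpure : ∀ i (I : Ideal (F i)), (I.map (Subalgebra.inclusion (hFU i)).toRingHom).comap
      (Subalgebra.inclusion (hFU i)).toRingHom ≤ I := by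
    intro i I
    have key : ∀ y ∈ I.map (Subalgebra.inclusion (hFU i)).toRingHom, ∃ j : c, ∃ h : F i ≤ F j,
        PureSub (F i) (F j) ∧
        ∃ z ∈ I.map (Subalgebra.inclusion h).toRingHom, (z : K) = (y : K) := by
      intro y hy
      have up : ∀ (j k : c) (h : F i ≤ F j) (h' : F j ≤ F k) (z : F j),
          z ∈ I.map (Subalgebra.inclusion h).toRingHom →
          Subalgebra.inclusion h' z ∈ I.map (Subalgebra.inclusion (h.trans h')).toRingHom := by
        intro j k h h' z hz
        have : (Subalgebra.inclusion (h.trans h')).toRingHom =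
          (Subalgebra.inclusion h').toRingHom.comp (Subalgebra.inclusion h).toRingHom := by ext; rfl
        rw [this, ← Ideal.map_map]
        exact Ideal.mem_map_of_mem (Subalgebra.inclusion h').toRingHom hz
      induction hy using Submodule.span_induction with
      | mem x hx =>
        obtain ⟨w, hw, rfl⟩ := hx
        exact ⟨i, le_rfl, PureSub.refl _, Subalgebra.inclusion le_rfl w,
          Ideal.mem_map_of_mem (Subalgebra.inclusion le_rfl).toRingHom hw, rfl⟩
      | zero => exact ⟨i, le_rfl, PureSub.refl _, 0, zero_mem _, rfl⟩
      | add x y _ _ hx hy =>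
        obtain ⟨j, h, hp, z, hz, hzx⟩ := hx
        obtain ⟨j', h', hp', z', hz', hzx'⟩ := hy
        obtain ⟨k, h1, h2⟩ := htot j j'
        refine ⟨k, h.trans h1.1, hp.trans h1, _, add_mem (up j k h h1.1 z hz)
          (up j' k h' h2.1 z' hz'), ?_⟩
        simp [hzx, hzx']
      | smul a x _ hx =>
        obtain ⟨j, h, hp, z, hz, hzx⟩ := hx
        obtain ⟨j', hj'⟩ := (hU a).mp a.2
        obtain ⟨k, h1, h2⟩ := htot j j'
        refine ⟨k, h.trans h1.1, hp.trans h1, ⟨a, h2.1 hj'⟩ * _, Ideal.mul_mem_left _ _ (up j k h h1.1 z hz), ?_⟩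
        simp [hzx]
    intro x hx
    obtain ⟨j, h, ⟨h', hp⟩, z, hz, hzx⟩ := key _ hx
    apply hp I
    rw [Ideal.mem_comap]
    convert hz
    exact Subtype.ext hzx.symm
  have hN : ∀ i, IsNoetherianRing (F i) := fun i => i.1.2.1
  have hL : ∀ i, IsLocalRing (F i) := fun i => i.1.2.2.1
  have hM : ∀ i, (maximalIdeal (F i)).map (Subalgebra.inclusion (hFU i)).toRingHom =
      (maximalIdeal R).map (algebraMap R U) := by
    intro i
    have : maximalIdeal (F i) = (maximalIdeal R).map (algebraMap R (F i)) := i.1.2.2.2.1.symm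
    rw [this, Ideal.map_map]
    rfl
  obtain ⟨hUN, hUL, hUM⟩ := noeth_union (fun i => F i)
    (fun i => (Subalgebra.inclusion (hFU i)).toRingHom) hdir hpure _ hM
  refine ⟨⟨U, hUN, hUL, hUM.symm, ?_⟩, fun A hA => ⟨hFU ⟨A, hA⟩, hpure ⟨A, hA⟩⟩⟩
  refine Module.Flat.of_forall_isTrivialRelation ?_
  intro l f x hfx
  obtain ⟨i, hi⟩ := hdir (Finset.univ.image x)
  have hi' : ∀ t, ∃ y : F i, Subalgebra.inclusion (hFU i) y = x t := fun t => hi (x t) (by simp)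
  choose y hy using hi'
  have : Module.Flat R (F i) := i.1.2.2.2.2
  have h0 : ∑ t, f t • y t = 0 := by
    apply Subalgebra.inclusion_injective (hFU i)
    rw [map_sum, map_zero, ← hfx]
    simp [← hy]
  obtain ⟨k, a, w, h1, h2⟩ := Module.Flat.isTrivialRelation_of_sum_smul_eq_zero h0
  refine ⟨k, a, fun j => Subalgebra.inclusion (hFU i) (w j), fun t => ?_, h2⟩
  rw [← hy, h1, map_sum]
  simp

theorem adjoin_step {R K : Type} [CommRing R] [IsRegularLocalRing R] [Field K] [Algebra R K]
    [IsAlgClosed K]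
    (A : Subalgebra R K) (hA : GoodSub R K A) [IsLocalRing A] (f : A[X]) (hf : f.Monic)
    (hirr : Irreducible (f.map (residue A))) :
    ∃ B, GoodSub R K B ∧ PureSub A B ∧ ∃ α ∈ B, aeval α f = 0 := by
  obtain ⟨hN, hL, hm, hflat⟩ := hA
  obtain ⟨hloc, hmB⟩ := adjoinRoot_local f hf hirr
  have hfin : Module.Finite A (AdjoinRoot f) := hf.finite_adjoinRoot
  have hfree : Module.Free A (AdjoinRoot f) := hf.free_adjoinRoot
  have : IsNoetherianRing (AdjoinRoot f) := IsNoetherianRing.of_finite A (AdjoinRoot f)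
  have hflatB : Module.Flat R (AdjoinRoot f) := Module.Flat.trans R A _
  have hmRB : (maximalIdeal R).map (algebraMap R (AdjoinRoot f)) = maximalIdeal (AdjoinRoot f) := by
    rw [IsScalarTower.algebraMap_eq R A (AdjoinRoot f), ← Ideal.map_map, hm, hmB]
  have hreg : IsRegularLocalRing (AdjoinRoot f) := regular_of_flat hmRB
  have hdom : IsDomain (AdjoinRoot f) := isDomain_of_regular _ _ rfl
  have hdeg : f.degree ≠ 0 := by
    intro h
    have h1 := hirr.natDegree_pos
    rw [hf.natDegree_map, natDegree_eq_of_degree_eq_some h] at h1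
    exact absurd h1 (lt_irrefl _)
  obtain ⟨α, hα⟩ := IsAlgClosed.exists_aeval_eq_zero_of_injective K
    (FaithfulSMul.algebraMap_injective A K) f hdeg
  let φ : AdjoinRoot f →ₐ[A] K := AdjoinRoot.liftAlgHom f (Algebra.ofId A K) α hα
  have hinj : Function.Injective φ := by
    rw [← RingHom.coe_coe, RingHom.injective_iff_ker_eq_bot]
    have hIntegral : Algebra.IsIntegral A (AdjoinRoot f) := inferInstance
    apply Ideal.eq_bot_of_comap_eq_bot (R := A)
    rw [eq_bot_iff]
    intro a ha
    rw [Ideal.mem_comap, RingHom.mem_ker] at ha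
    have : algebraMap A K a = 0 := (φ.commutes a).symm.trans ha
    rw [Ideal.mem_bot]
    exact FaithfulSMul.algebraMap_injective A K (by rw [this, map_zero])
  let ψ : AdjoinRoot f →ₐ[R] K := φ.restrictScalars R
  have hinj' : Function.Injective ψ := hinj
  let e : AdjoinRoot f ≃ₐ[R] ψ.range := AlgEquiv.ofInjective ψ hinj'
  have hle : A ≤ ψ.range := by
    intro a ha
    refine ⟨algebraMap A _ ⟨a, ha⟩, ?_⟩
    exact φ.commutes _
  refine ⟨ψ.range, goodSub_of_equiv _ (AdjoinRoot f) hmRB e, ⟨hle, fun I x hx => ?_⟩,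
    α, ⟨AdjoinRoot.root f, ?_⟩, hα⟩
  · have hcomp : (Subalgebra.inclusion hle).toRingHom =
      (e.toRingEquiv : AdjoinRoot f →+* ψ.range).comp (algebraMap A (AdjoinRoot f)) := by
      ext a
      exact (φ.commutes a).symm
    rw [hcomp, ← Ideal.map_map, ← Ideal.comap_comap] at hx
    have hbij := Ideal.comap_map_of_bijective (e.toRingEquiv : AdjoinRoot f →+* ψ.range) e.bijective
      (I := I.map (algebraMap A (AdjoinRoot f)))
    rw [hbij] at hx
    rwa [Ideal.comap_map_eq_self_of_faithfullyFlat] at hx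
  · exact AdjoinRoot.liftAlgHom_root (h := hα) ..

theorem maximal_algClosed {R K : Type} [CommRing R] [IsRegularLocalRing R] [Field K] [Algebra R K]
    [IsAlgClosed K] (A : Subalgebra R K) (hA : GoodSub R K A) [IsLocalRing A]
    (hmax : ∀ B, GoodSub R K B → PureSub A B → B ≤ A) : IsAlgClosed (ResidueField A) := by
  refine IsAlgClosed.of_exists_root _ fun p hp hirr => ?_
  obtain ⟨f, hfp, -, hf⟩ := lifts_and_natDegree_eq_and_monic (f := residue A) (p := p)
    ((mem_lifts p).mpr (map_surjective _ residue_surjective p)) hp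
  obtain ⟨B, hB, hAB, α, hα, h0⟩ := adjoin_step A hA f hf (hfp ▸ hirr)
  have hαA : α ∈ A := hmax B hB hAB hα
  refine ⟨residue A ⟨α, hαA⟩, ?_⟩
  rw [← hfp, eval_map, eval₂_at_apply]
  have : eval (⟨α, hαA⟩ : A) f = 0 := by
    apply FaithfulSMul.algebraMap_injective A K
    rw [map_zero, ← h0, ← aeval_algebraMap_apply_eq_algebraMap_eval]
    rfl
  rw [this, map_zero]

end FlatExt

/-- Every regular local ring `(R₀, m₀)` admits a flat local extension `(R₀', m₀')`
which is again a regular local ring, with `m₀R₀' = m₀'` and algebraically closed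
residue field. -/
theorem exists_flat_regular_extension_algClosed_residue
    (R0 : Type) [CommRing R0] [IsLocalRing R0] (hreg : IsRegularLocal R0) :
    ∃ (R0' : Type) (_ : CommRing R0'),
      ∃ (_ : IsLocalRing R0') (f : R0 →+* R0'),
        Function.Injective f ∧ IsLocalHom f ∧
        (letI := f.toAlgebra; Module.Flat R0 R0') ∧
        Ideal.map f (maximalIdeal R0) = maximalIdeal R0' ∧
        IsAlgClosed (ResidueField R0') ∧
        IsRegularLocal R0' := by
  have hN : IsNoetherianRing R0 := hreg.1
  have hR : IsRegularLocalRing R0 :=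
    (IsRegularLocalRing.iff_finrank_cotangentSpace R0).mpr hreg.2.symm
  have hD : IsDomain R0 := isDomain_of_regular _ _ rfl
  let K := AlgebraicClosure (FractionRing R0)
  have hinjK : Function.Injective (algebraMap R0 K) := by
    rw [IsScalarTower.algebraMap_eq R0 (FractionRing R0) K]
    exact (algebraMap (FractionRing R0) K).injective.comp (IsFractionRing.injective R0 (FractionRing R0))
  have hbot : GoodSub R0 K ⊥ := by
    refine goodSub_of_equiv ⊥ R0 ?_ (Algebra.botEquivOfInjective hinjK).symm
    exact Ideal.map_id _
  obtain ⟨⟨A, hA⟩, hmax⟩ := exists_maximal_of_chains_bounded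
    (r := fun A B : {A : Subalgebra R0 K // GoodSub R0 K A} => PureSub A.1 B.1)
    (fun c hc => by
      rcases c.eq_empty_or_nonempty with rfl | hne
      · exact ⟨⟨⊥, hbot⟩, by simp⟩
      · exact chain_bound c hc hne)
    (fun h1 h2 => h1.trans h2)
  obtain ⟨hAN, hAL, hm, hflat⟩ := id hA
  have hreg' : IsRegularLocalRing A := regular_of_flat hm
  refine ⟨A, inferInstance, hAL, algebraMap R0 A, ?_, ?_, ?_, hm, ?_, hAN, ?_⟩
  · intro x y h
    exact hinjK (congrArg (Subtype.val) h)
  · exact ((local_hom_TFAE (algebraMap R0 A)).out 2 0).mp hm.le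
  · exact RingHom.flat_algebraMap_iff.mpr hflat
  · exact maximal_algClosed A hA fun B hB hAB => (hmax ⟨B, hB⟩ hAB).1
  · exact ((IsRegularLocalRing.iff_finrank_cotangentSpace A).mp hreg').symm
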